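/- arXiv:1603.07243 — 3 statements merged into one kernel-verified Lean document; each statement's English description precedes it below -/
import Mathlib

section
/- Let G be a finite simple graph, k a positive integer, and v a vertex of G. If γ_{P,k}(G − v) = γ_{P,k}(G) − 1, then rad_{P,k}(G) ≤ rad_{P,k}(G − v), where G − v is the graph obtained from G by deleting v and all its incident edges. -/
open SimpleGraph

variable {V : Type*}

/-- The closed neighbourhood `N_G[v]` of a vertex. -/
def closedNbhd (G : SimpleGraph V) (v : V) : Set V := insert v (G.neighborSet v)

/-- The closed neighbourhood `N_G[X]` of a set of vertices. -/
def closedNbhdSet (G : SimpleGraph V) (X : Set V) : Set V := ⋃ v ∈ X, closedNbhd G v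

/-- The sets `P^i_{G,k}(S)` of vertices monitored by `S` at step `i`. -/
def monitored (G : SimpleGraph V) (k : ℕ) (S : Set V) : ℕ → Set V
  | 0 => closedNbhdSet G S
  | i + 1 =>
      ⋃ v ∈ {w | w ∈ monitored G k S i ∧ (closedNbhd G w \ monitored G k S i).ncard ≤ k},
        closedNbhd G v

/-- `S` is a `k`-power dominating set of `G`. -/
def IsPDS (G : SimpleGraph V) (k : ℕ) (S : Set V) : Prop :=
  ∃ i, monitored G k S i = Set.univ

/-- The `k`-power domination number `γ_{P,k}(G)`. -/
noncomputable def pdn (G : SimpleGraph V) (k : ℕ) : ℕ :=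
  sInf {n | ∃ S : Set V, IsPDS G k S ∧ S.ncard = n}

/-- The radius `rad_{P,k}(G,S)` of a `k`-PDS `S`. -/
noncomputable def radPDS (G : SimpleGraph V) (k : ℕ) (S : Set V) : ℕ :=
  1 + sInf {i | monitored G k S i = Set.univ}

/-- The `k`-propagation radius `rad_{P,k}(G)`. -/
noncomputable def propRad (G : SimpleGraph V) (k : ℕ) : ℕ :=
  sInf {r | ∃ S : Set V, IsPDS G k S ∧ S.ncard = pdn G k ∧ radPDS G k S = r}

lemma isPDS_univ (G : SimpleGraph V) (k : ℕ) : IsPDS G k Set.univ :=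
  ⟨0, Set.eq_univ_of_forall fun x => Set.mem_biUnion (Set.mem_univ x) (Set.mem_insert x _)⟩

lemma exists_isPDS_ncard_eq_pdn (G : SimpleGraph V) (k : ℕ) :
    ∃ S : Set V, IsPDS G k S ∧ S.ncard = pdn G k :=
  Nat.sInf_mem (s := {n | ∃ S : Set V, IsPDS G k S ∧ S.ncard = n}) ⟨_, _, isPDS_univ G k, rfl⟩

lemma exists_radPDS_eq_propRad (G : SimpleGraph V) (k : ℕ) :
    ∃ S : Set V, IsPDS G k S ∧ S.ncard = pdn G k ∧ radPDS G k S = propRad G k := by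
  obtain ⟨S, hS, hc⟩ := exists_isPDS_ncard_eq_pdn G k
  exact Nat.sInf_mem
    (s := {r | ∃ S : Set V, IsPDS G k S ∧ S.ncard = pdn G k ∧ radPDS G k S = r})
    ⟨_, S, hS, hc, rfl⟩

lemma propRad_le_of_monitored_eq_univ {G : SimpleGraph V} {k i : ℕ} {S : Set V}
    (hc : S.ncard = pdn G k) (hi : monitored G k S i = Set.univ) : propRad G k ≤ 1 + i := by
  have hS : propRad G k ≤ radPDS G k S := Nat.sInf_le ⟨S, ⟨i, hi⟩, hc, rfl⟩
  have hr : sInf {j | monitored G k S j = Set.univ} ≤ i := Nat.sInf_le hi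
  exact hS.trans (Nat.add_le_add_left hr 1)

/-- The closed neighbourhood of a vertex of `S` is monitored at every step. -/
lemma closedNbhd_subset_monitored (G : SimpleGraph V) (k : ℕ) {S : Set V} {v : V} (hv : v ∈ S)
    (i : ℕ) : closedNbhd G v ⊆ monitored G k S i := by
  induction i with
  | zero => exact Set.subset_biUnion_of_mem hv
  | succ i ih =>
    refine Set.subset_biUnion_of_mem (u := closedNbhd G) ⟨ih (Set.mem_insert _ _), ?_⟩
    simp [Set.sdiff_eq_empty.mpr ih]

lemma val_mem_closedNbhd_iff {G : SimpleGraph V} {s : Set V} {x w : s} :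
    (x : V) ∈ closedNbhd G w ↔ x ∈ closedNbhd (G.induce s) w := by
  simp [closedNbhd, Subtype.ext_iff]

/-- Adding the vertices outside `s` to a set monitoring `G.induce s` monitors `G` at least as
fast. -/
lemma val_mem_monitored_of_mem [Finite V] (G : SimpleGraph V) (k : ℕ) (s : Set V) (S : Set s)
    (i : ℕ) {x : s} (hx : x ∈ monitored (G.induce s) k S i) :
    (x : V) ∈ monitored G k (Subtype.val '' S ∪ sᶜ) i := by
  induction i generalizing x with
  | zero =>
    obtain ⟨w, hw, hxw⟩ := Set.mem_iUnion₂.mp hx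
    exact Set.mem_biUnion (Or.inl ⟨w, hw, rfl⟩) (val_mem_closedNbhd_iff.mpr hxw)
  | succ i ih =>
    obtain ⟨w, ⟨hw, hwk⟩, hxw⟩ := Set.mem_iUnion₂.mp hx
    refine Set.mem_biUnion ⟨ih hw, ?_⟩ (val_mem_closedNbhd_iff.mpr hxw)
    have hsub : closedNbhd G w \ monitored G k (Subtype.val '' S ∪ sᶜ) i ⊆
        Subtype.val '' (closedNbhd (G.induce s) w \ monitored (G.induce s) k S i) := by
      rintro y ⟨hyw, hy⟩
      have hys : y ∈ s := by
        by_contra hys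
        exact hy (closedNbhd_subset_monitored G k (Or.inr hys) i (Set.mem_insert _ _))
      exact ⟨⟨y, hys⟩, ⟨val_mem_closedNbhd_iff.mp hyw, fun h => hy (ih h)⟩, rfl⟩
    exact (Set.ncard_le_ncard hsub).trans ((Set.ncard_image_le).trans hwk)

theorem propRad_vertex_deletion {V : Type*} [Fintype V]
    (G : SimpleGraph V) (k : ℕ) (hk : 0 < k) (v : V)
    (h : pdn (G.induce {u | u ≠ v}) k + 1 = pdn G k) :
    propRad G k ≤ propRad (G.induce {u | u ≠ v}) k := by
  obtain ⟨S, hS, hc, hr⟩ := exists_radPDS_eq_propRad (G.induce {u | u ≠ v}) k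
  have hi := Nat.sInf_mem (s := {i | monitored (G.induce {u | u ≠ v}) k S i = Set.univ}) hS
  rw [← hr]
  refine propRad_le_of_monitored_eq_univ (S := Subtype.val '' S ∪ {u | u ≠ v}ᶜ) ?_ ?_
  · have hcompl : {u | u ≠ v}ᶜ = {v} := by ext; simp
    have hv : v ∉ Subtype.val '' S := by
      rintro ⟨x, -, hx⟩
      exact x.2 hx
    rw [← h, ← hc, hcompl, Set.union_singleton, Set.ncard_insert_of_notMem hv,
      Set.ncard_image_of_injective _ Subtype.val_injective]
  · refine Set.eq_univ_of_forall fun x => ?_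
    by_cases hx : x ∈ {u | u ≠ v}
    · exact val_mem_monitored_of_mem G k _ S _ (x := ⟨x, hx⟩) (hi.ge (Set.mem_univ _))
    · exact closedNbhd_subset_monitored G k (Or.inr hx) _ (Set.mem_insert _ _)
end

section
/- Let k be a positive integer, a ≥ k + 2, and G = K_a □ K_a the Cartesian product of two complete graphs on a vertices. Then γ_{P,k}(G − v) = a − k − 1 for every vertex v of G, where G − v is the graph obtained from G by deleting v and all its incident edges. -/
open SimpleGraph

variable {V : Type*}

lemma mem_closedNbhd_self (G : SimpleGraph V) (v : V) : v ∈ closedNbhd G v :=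
  Set.mem_insert _ _

lemma mem_closedNbhdSet {G : SimpleGraph V} {X : Set V} {x : V} :
    x ∈ closedNbhdSet G X ↔ ∃ v ∈ X, x ∈ closedNbhd G v := by
  simp [closedNbhdSet]

lemma mem_monitored_succ {G : SimpleGraph V} {k : ℕ} {S : Set V} {i : ℕ} {x : V} :
    x ∈ monitored G k S (i + 1) ↔ ∃ v ∈ monitored G k S i,
      (closedNbhd G v \ monitored G k S i).ncard ≤ k ∧ x ∈ closedNbhd G v := by
  simp [monitored, and_assoc]

lemma exists_closedNbhd_subset_monitored {G : SimpleGraph V} {k : ℕ} {S : Set V} {i : ℕ} {x : V}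
    (hx : x ∈ monitored G k S i) :
    ∃ v, x ∈ closedNbhd G v ∧ closedNbhd G v ⊆ monitored G k S i := by
  cases i with
  | zero =>
    obtain ⟨v, hv, hxv⟩ := mem_closedNbhdSet.1 hx
    exact ⟨v, hxv, fun y hy => mem_closedNbhdSet.2 ⟨v, hv, hy⟩⟩
  | succ i =>
    obtain ⟨v, hv, hc, hxv⟩ := mem_monitored_succ.1 hx
    exact ⟨v, hxv, fun y hy => mem_monitored_succ.2 ⟨v, hv, hc, hy⟩⟩

lemma monitored_subset_succ (G : SimpleGraph V) (k : ℕ) (S : Set V) (i : ℕ) :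
    monitored G k S i ⊆ monitored G k S (i + 1) := by
  intro x hx
  obtain ⟨v, hxv, hv⟩ := exists_closedNbhd_subset_monitored hx
  refine mem_monitored_succ.2 ⟨v, hv (mem_closedNbhd_self G v), ?_, hxv⟩
  simp [Set.sdiff_eq_empty.2 hv]

/-- The rook's graph `K_a □ K_a` with the vertex `v` deleted. -/
abbrev rookDelete (a : ℕ) (v : Fin a × Fin a) : SimpleGraph {u : Fin a × Fin a | u ≠ v} :=
  ((⊤ : SimpleGraph (Fin a)) □ (⊤ : SimpleGraph (Fin a))).induce {u | u ≠ v}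

section rookDelete

variable {a k : ℕ} {v : Fin a × Fin a}

lemma mem_closedNbhd_rookDelete {x w : {u : Fin a × Fin a | u ≠ v}} :
    x ∈ closedNbhd (rookDelete a v) w ↔ x.1.1 = w.1.1 ∨ x.1.2 = w.1.2 := by
  simp only [closedNbhd, Set.mem_insert_iff, mem_neighborSet, comap_adj,
    Function.Embedding.subtype_apply, boxProd_adj, top_adj, Subtype.ext_iff, Prod.ext_iff]
  grind

lemma lt_ncard_row_inter {B : Finset (Fin a)} (hB : k + 2 ≤ B.card) (r : Fin a)
    {T : Set {u : Fin a × Fin a | u ≠ v}} (hT : ∀ x, x.1.1 = r → x.1.2 ∈ B → x ∈ T) :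
    k < T.ncard := by
  have h : ((B.erase v.2 : Finset (Fin a)) : Set (Fin a)) ⊆ (fun x => x.1.2) '' T := by
    intro c hc
    rw [Finset.mem_coe, Finset.mem_erase] at hc
    exact ⟨⟨(r, c), fun h => hc.1 (congrArg Prod.snd h)⟩, hT _ rfl hc.2, rfl⟩
  have h1 := Set.ncard_le_ncard h (Set.toFinite _)
  have h2 := Set.ncard_image_le (f := fun x : {u : Fin a × Fin a | u ≠ v} => x.1.2)
    (Set.toFinite T)
  rw [Set.ncard_coe_finset] at h1
  have h3 := Finset.pred_card_le_card_erase (s := B) (a := v.2)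
  omega

lemma lt_ncard_col_inter {A : Finset (Fin a)} (hA : k + 2 ≤ A.card) (c : Fin a)
    {T : Set {u : Fin a × Fin a | u ≠ v}} (hT : ∀ x, x.1.2 = c → x.1.1 ∈ A → x ∈ T) :
    k < T.ncard := by
  have h : ((A.erase v.1 : Finset (Fin a)) : Set (Fin a)) ⊆ (fun x => x.1.1) '' T := by
    intro r hr
    rw [Finset.mem_coe, Finset.mem_erase] at hr
    exact ⟨⟨(r, c), fun h => hr.1 (congrArg Prod.fst h)⟩, hT _ rfl hr.2, rfl⟩
  have h1 := Set.ncard_le_ncard h (Set.toFinite _)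
  have h2 := Set.ncard_image_le (f := fun x : {u : Fin a × Fin a | u ≠ v} => x.1.1)
    (Set.toFinite T)
  rw [Set.ncard_coe_finset] at h1
  have h3 := Finset.pred_card_le_card_erase (s := A) (a := v.1)
  omega

lemma monitored_rookDelete_avoids {S : Set {u : Fin a × Fin a | u ≠ v}} {A B : Finset (Fin a)}
    (hA : k + 2 ≤ A.card) (hB : k + 2 ≤ B.card)
    (hSA : ∀ s ∈ S, s.1.1 ∉ A) (hSB : ∀ s ∈ S, s.1.2 ∉ B) (i : ℕ) :
    ∀ x ∈ monitored (rookDelete a v) k S i, ¬ (x.1.1 ∈ A ∧ x.1.2 ∈ B) := by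
  induction i with
  | zero =>
    rintro x hx ⟨hxA, hxB⟩
    obtain ⟨s, hs, hxs⟩ := mem_closedNbhdSet.1 hx
    rcases mem_closedNbhd_rookDelete.1 hxs with h | h
    · exact hSA s hs (h ▸ hxA)
    · exact hSB s hs (h ▸ hxB)
  | succ i ih =>
    rintro x hx ⟨hxA, hxB⟩
    obtain ⟨w, hw, hc, hxw⟩ := mem_monitored_succ.1 hx
    refine hc.not_gt ?_
    rcases mem_closedNbhd_rookDelete.1 hxw with h | h
    · refine lt_ncard_row_inter hB w.1.1 fun y hy hyB => ⟨?_, fun hy' => ih y hy' ⟨?_, hyB⟩⟩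
      · exact mem_closedNbhd_rookDelete.2 (Or.inl hy)
      · rwa [hy, ← h]
    · refine lt_ncard_col_inter hA w.1.2 fun y hy hyA => ⟨?_, fun hy' => ih y hy' ⟨hyA, ?_⟩⟩
      · exact mem_closedNbhd_rookDelete.2 (Or.inr hy)
      · rwa [hy, ← h]

lemma le_ncard_of_isPDS_rookDelete {S : Set {u : Fin a × Fin a | u ≠ v}}
    (hS : IsPDS (rookDelete a v) k S) : a - k - 1 ≤ S.ncard := by
  classical
  by_contra! hlt
  obtain ⟨i, hi⟩ := hS
  let F := S.toFinite.toFinset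
  have hF : F.card = S.ncard := (Set.ncard_eq_toFinset_card S).symm
  have hcard (f : {u : Fin a × Fin a | u ≠ v} → Fin a) : k + 2 ≤ (F.image f)ᶜ.card := by
    have h1 := Finset.card_image_le (s := F) (f := f)
    rw [Finset.card_compl, Fintype.card_fin]
    omega
  have hmem (f : {u : Fin a × Fin a | u ≠ v} → Fin a) : ∀ s ∈ S, f s ∉ (F.image f)ᶜ := by
    intro s hs
    rw [Finset.mem_compl, not_not]
    exact Finset.mem_image_of_mem f (S.toFinite.mem_toFinset.2 hs)
  have hA := hcard fun x => x.1.1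
  have hB := hcard fun x => x.1.2
  obtain ⟨r, hr⟩ := Finset.card_pos.1 (lt_of_lt_of_le (by omega) hA)
  obtain ⟨c, hc, hcv⟩ := Finset.exists_mem_ne (lt_of_lt_of_le (by omega) hB) v.2
  exact monitored_rookDelete_avoids hA hB (hmem _) (hmem _) i
    ⟨(r, c), fun h => hcv (congrArg Prod.snd h)⟩ (hi ▸ Set.mem_univ _) ⟨hr, hc⟩

lemma exists_isPDS_rookDelete (ha : k + 2 ≤ a) (v : Fin a × Fin a) :
    ∃ S, IsPDS (rookDelete a v) k S ∧ S.ncard = a - k - 1 := by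
  obtain ⟨A, hvA, -, hA⟩ := Finset.exists_subsuperset_card_eq
    (Finset.subset_univ {v.1}) (n := k + 1) (by simp) (by simp; omega)
  rw [Finset.singleton_subset_iff] at hvA
  let σ := Equiv.swap v.1 v.2
  have hσ : σ v.1 = v.2 := Equiv.swap_apply_left _ _
  have hne {r c : Fin a} (hr : r ∉ A) : (r, c) ≠ v := fun h => hr (by rwa [← h] at hvA)
  let s : {r // r ∉ A} → {u : Fin a × Fin a | u ≠ v} := fun r => ⟨(r.1, σ r.1), hne r.2⟩
  have hs : Function.Injective s := fun r r' h =>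
    Subtype.ext (congrArg (fun x : {u : Fin a × Fin a | u ≠ v} => x.1.1) h)
  refine ⟨Set.range s, ⟨2, Set.eq_univ_of_forall fun x => ?_⟩, ?_⟩
  swap
  · rw [← Set.image_univ, Set.ncard_image_of_injective _ hs, Set.ncard_univ,
      Nat.card_eq_fintype_card, Fintype.card_subtype_compl, Fintype.card_fin, Fintype.card_coe, hA]
    omega
  obtain ⟨r₀, hr₀⟩ : ∃ r₀, r₀ ∉ A := by
    by_contra! h
    rw [Finset.eq_univ_of_forall h, Finset.card_univ, Fintype.card_fin] at hA
    omega
  have h0 (y : {u : Fin a × Fin a | u ≠ v}) (hy : y.1.1 ∉ A ∨ σ.symm y.1.2 ∉ A) :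
      y ∈ monitored (rookDelete a v) k (Set.range s) 0 := by
    rcases hy with hy | hy
    · exact mem_closedNbhdSet.2 ⟨_, ⟨⟨_, hy⟩, rfl⟩, mem_closedNbhd_rookDelete.2 (Or.inl rfl)⟩
    · exact mem_closedNbhdSet.2 ⟨_, ⟨⟨_, hy⟩, rfl⟩,
        mem_closedNbhd_rookDelete.2 (Or.inr (σ.apply_symm_apply _).symm)⟩
  have hAv : (((A.erase v.1 : Finset (Fin a)) : Set (Fin a))).ncard = k := by
    rw [Set.ncard_coe_finset, Finset.card_erase_of_mem hvA, hA, Nat.add_sub_cancel]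
  have h1 (y : {u : Fin a × Fin a | u ≠ v}) (hy : y.1.1 = v.1) :
      y ∈ monitored (rookDelete a v) k (Set.range s) 1 := by
    have hw : (v.1, σ r₀) ≠ v := fun h =>
      hr₀ (by rwa [σ.injective ((congrArg Prod.snd h).trans hσ.symm)])
    refine mem_monitored_succ.2 ⟨⟨_, hw⟩, h0 _ (Or.inr (by simpa using hr₀)), ?_,
      mem_closedNbhd_rookDelete.2 (Or.inl hy)⟩
    have key : ∀ z ∈ closedNbhd (rookDelete a v) ⟨_, hw⟩ \
        monitored (rookDelete a v) k (Set.range s) 0, z.1.1 = v.1 ∧ σ.symm z.1.2 ∈ A := by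
      rintro z ⟨hz, hz0⟩
      have hzA : σ.symm z.1.2 ∈ A := by
        by_contra h
        exact hz0 (h0 z (Or.inr h))
      refine ⟨(mem_closedNbhd_rookDelete.1 hz).resolve_right fun h => hr₀ ?_, hzA⟩
      simpa [h] using hzA
    refine (Set.ncard_le_ncard_of_injOn (fun z => σ.symm z.1.2) (fun z hz => ?_)
      (fun z hz z' hz' h => ?_)).trans hAv.le
    · obtain ⟨hz1, hz2⟩ := key z hz
      refine Finset.mem_coe.2 (Finset.mem_erase.2 ⟨fun h => z.2 (Prod.ext hz1 ?_), hz2⟩)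
      rw [← hσ, ← h, σ.apply_symm_apply]
    · exact Subtype.ext (Prod.ext ((key z hz).1.trans (key z' hz').1.symm) (σ.symm.injective h))
  refine mem_monitored_succ.2 ⟨⟨(r₀, x.1.2), hne hr₀⟩,
    monitored_subset_succ _ _ _ _ (h0 _ (Or.inl hr₀)), ?_,
    mem_closedNbhd_rookDelete.2 (Or.inr rfl)⟩
  have key : ∀ z ∈ closedNbhd (rookDelete a v) ⟨(r₀, x.1.2), hne hr₀⟩ \
      monitored (rookDelete a v) k (Set.range s) 1,
      z.1.2 = x.1.2 ∧ z.1.1 ∈ A.erase v.1 := by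
    rintro z ⟨hz, hz1⟩
    have hzA : z.1.1 ∈ A := by
      by_contra h
      exact hz1 (monitored_subset_succ _ _ _ _ (h0 z (Or.inl h)))
    refine ⟨(mem_closedNbhd_rookDelete.1 hz).resolve_left fun h => hr₀ ?_,
      Finset.mem_erase.2 ⟨fun h => hz1 (h1 z h), hzA⟩⟩
    rwa [show z.1.1 = r₀ from h] at hzA
  refine (Set.ncard_le_ncard_of_injOn (fun z => z.1.1)
    (fun z hz => Finset.mem_coe.2 (key z hz).2) fun z hz z' hz' h => ?_).trans hAv.le
  exact Subtype.ext (Prod.ext h ((key z hz).1.trans (key z' hz').1.symm))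

end rookDelete

theorem pdn_boxProd_complete_vertex_deletion (k a : ℕ) (hk : 0 < k) (ha : k + 2 ≤ a)
    (v : Fin a × Fin a) :
    pdn (((⊤ : SimpleGraph (Fin a)) □ (⊤ : SimpleGraph (Fin a))).induce {u | u ≠ v}) k =
      a - k - 1 := by
  refine le_antisymm (Nat.sInf_le (exists_isPDS_rookDelete ha v)) ?_
  refine le_csInf ⟨_, exists_isPDS_rookDelete ha v⟩ ?_
  rintro _ ⟨S, hS, rfl⟩
  exact le_ncard_of_isPDS_rookDelete hS
end

section
/- Let k be a positive integer and let G = K_{k+2,k+2} be the complete bipartite graph with both parts of size k + 2. Then γ_{P,k}(G) = 2, and for every edge e of G, γ_{P,k}(G − e) = 1, where G − e is the graph obtained from G by removing the edge e. -/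
open SimpleGraph

variable {V : Type*}

theorem closedNbhdSet_singleton (G : SimpleGraph V) (v : V) :
    closedNbhdSet G {v} = closedNbhd G v := by
  simp [closedNbhdSet]

/-- A set closed under the `k`-propagation rule contains everything that is monitored. -/
theorem monitored_subset_of_closed [Finite V] {G : SimpleGraph V} {k : ℕ} {S T : Set V}
    (hS : closedNbhdSet G S ⊆ T)
    (hT : ∀ w ∈ T, (closedNbhd G w \ T).ncard ≤ k → closedNbhd G w ⊆ T) (i : ℕ) :
    monitored G k S i ⊆ T := by
  induction i with
  | zero => exact hS
  | succ i ih =>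
    refine Set.iUnion₂_subset fun w hw => hT w (ih hw.1) (le_trans ?_ hw.2)
    exact Set.ncard_le_ncard (Set.sdiff_subset_sdiff_right ih) (Set.toFinite _)

theorem closedNbhd_subset_monitored_succ {G : SimpleGraph V} {k i : ℕ} {S : Set V} {v : V}
    (hv : v ∈ monitored G k S i) (h : (closedNbhd G v \ monitored G k S i).ncard ≤ k) :
    closedNbhd G v ⊆ monitored G k S (i + 1) :=
  Set.subset_biUnion_of_mem (u := fun w => closedNbhd G w)
    (s := {w | w ∈ monitored G k S i ∧ (closedNbhd G w \ monitored G k S i).ncard ≤ k}) ⟨hv, h⟩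

theorem closedNbhd_subset_monitored_of_mem {G : SimpleGraph V} {k : ℕ} {S : Set V} {v : V}
    (hv : v ∈ S) (i : ℕ) : closedNbhd G v ⊆ monitored G k S i := by
  induction i with
  | zero => exact Set.subset_biUnion_of_mem (u := fun w => closedNbhd G w) hv
  | succ i ih =>
    refine closedNbhd_subset_monitored_succ (ih (Set.mem_insert _ _)) ?_
    simp [Set.sdiff_eq_empty.mpr ih]

theorem not_isPDS_empty [Nonempty V] (G : SimpleGraph V) (k : ℕ) : ¬ IsPDS G k ∅ := by
  rintro ⟨i, hi⟩
  have h (i : ℕ) : monitored G k ∅ i = ∅ := by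
    induction i with
    | zero => simp [monitored, closedNbhdSet]
    | succ i ih => simp_all [monitored]
  exact Set.empty_ne_univ ((h i).symm.trans hi)

theorem one_le_ncard_of_isPDS [Finite V] [Nonempty V] {G : SimpleGraph V} {k : ℕ} {S : Set V}
    (hS : IsPDS G k S) : 1 ≤ S.ncard := by
  refine Nat.one_le_iff_ne_zero.mpr fun h => not_isPDS_empty G k ?_
  rwa [(Set.ncard_eq_zero (Set.toFinite _)).mp h] at hS

/-- A `k`-PDS whose size is a lower bound for that of all others realises `pdn G k`. -/
theorem IsPDS.pdn_eq {G : SimpleGraph V} {k : ℕ} {S : Set V} (hS : IsPDS G k S)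
    (hmin : ∀ T, IsPDS G k T → S.ncard ≤ T.ncard) : pdn G k = S.ncard := by
  refine le_antisymm (Nat.sInf_le ⟨S, hS, rfl⟩) (le_csInf ⟨_, S, hS, rfl⟩ ?_)
  rintro _ ⟨T, hT, rfl⟩
  exact hmin T hT

theorem ncard_closedNbhd_diff_of_adj {n : ℕ} {v w : Fin n ⊕ Fin n}
    (h : (completeBipartiteGraph (Fin n) (Fin n)).Adj v w) :
    (closedNbhd (completeBipartiteGraph (Fin n) (Fin n)) w \
      closedNbhd (completeBipartiteGraph (Fin n) (Fin n)) v).ncard = n - 1 := by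
  rcases v with a | a <;> rcases w with b | b <;> simp at h
  · have : closedNbhd (completeBipartiteGraph (Fin n) (Fin n)) (Sum.inr b) \
        closedNbhd (completeBipartiteGraph (Fin n) (Fin n)) (Sum.inl a) =
          Sum.inl '' ({a}ᶜ : Set (Fin n)) := by
      ext (x | x) <;> simp [closedNbhd]
    rw [this, Set.ncard_image_of_injective _ Sum.inl_injective, Set.ncard_compl]
    simp
  · have : closedNbhd (completeBipartiteGraph (Fin n) (Fin n)) (Sum.inl b) \
        closedNbhd (completeBipartiteGraph (Fin n) (Fin n)) (Sum.inr a) =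
          Sum.inr '' ({a}ᶜ : Set (Fin n)) := by
      ext (x | x) <;> simp [closedNbhd]
    rw [this, Set.ncard_image_of_injective _ Sum.inr_injective, Set.ncard_compl]
    simp

theorem not_isPDS_singleton_completeBipartiteGraph (k : ℕ) (v : Fin (k + 2) ⊕ Fin (k + 2)) :
    ¬ IsPDS (completeBipartiteGraph (Fin (k + 2)) (Fin (k + 2))) k {v} := by
  set G := completeBipartiteGraph (Fin (k + 2)) (Fin (k + 2)) with hG
  rintro ⟨i, hi⟩
  have hsub : monitored G k {v} i ⊆ closedNbhd G v := by
    refine monitored_subset_of_closed (closedNbhdSet_singleton G v).subset ?_ i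
    rintro w (rfl | hw) hcard
    · exact subset_rfl
    · have := ncard_closedNbhd_diff_of_adj hw
      rw [← hG] at this
      omega
  have huniv := Set.univ_subset_iff.mp (hi ▸ hsub)
  obtain ⟨w, hw⟩ : ∃ w, G.Adj v w := by
    rcases v with a | a
    · exact ⟨Sum.inr a, by simp [hG]⟩
    · exact ⟨Sum.inl a, by simp [hG]⟩
  have := ncard_closedNbhd_diff_of_adj hw
  rw [← hG, huniv] at this
  simp at this

theorem isPDS_pair_completeBipartiteGraph {α β : Type*} (k : ℕ) (a : α) (b : β) :
    IsPDS (completeBipartiteGraph α β) k {Sum.inl a, Sum.inr b} := by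
  refine ⟨0, Set.eq_univ_of_forall ?_⟩
  rintro (x | x) <;> simp [monitored, closedNbhdSet, closedNbhd]

theorem exists_isPDS_singleton_deleteEdges (k : ℕ) (hk : 0 < k) (a b : Fin (k + 2)) :
    ∃ v, IsPDS ((completeBipartiteGraph (Fin (k + 2)) (Fin (k + 2))).deleteEdges
      {s(Sum.inl a, Sum.inr b)}) k {v} := by
  set G := (completeBipartiteGraph (Fin (k + 2)) (Fin (k + 2))).deleteEdges
    {s(Sum.inl a, Sum.inr b)} with hG
  obtain ⟨a', ha'⟩ := exists_ne a
  obtain ⟨b', hb'⟩ := exists_ne b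
  have hadj : ∀ x y, G.Adj (Sum.inl x) (Sum.inr y) ↔ ¬ (x = a ∧ y = b) := by
    intro x y
    simp [hG]
  have hmem (i : ℕ) := closedNbhd_subset_monitored_of_mem (G := G) (k := k)
    (Set.mem_singleton (Sum.inl a' : Fin (k + 2) ⊕ Fin (k + 2))) i
  have hright : ∀ i y, Sum.inr y ∈ monitored G k {Sum.inl a'} i := fun i y =>
    hmem i (Or.inr ((hadj a' y).mpr fun h => ha' h.1))
  have hleft : ∀ x, x ≠ a → Sum.inl x ∈ monitored G k {Sum.inl a'} 1 := by
    intro x hx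
    refine closedNbhd_subset_monitored_succ (hright 0 b) ?_
      (Or.inr ((hadj x b).mpr fun h => hx h.1).symm)
    have hsub : closedNbhd G (Sum.inr b) \ monitored G k {Sum.inl a'} 0 ⊆
        Sum.inl '' ({a', a}ᶜ : Set (Fin (k + 2))) := by
      rintro (z | z) ⟨hz, hz'⟩
      · refine ⟨z, ?_, rfl⟩
        rintro (rfl | rfl)
        · exact hz' (hmem 0 (Set.mem_insert _ _))
        · rcases hz with hz | hz
          · simp at hz
          · exact (hadj _ b).mp (hz.symm) ⟨rfl, rfl⟩
      · exact absurd (hright 0 z) hz'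
    refine (Set.ncard_le_ncard hsub (Set.toFinite _)).trans ?_
    rw [Set.ncard_image_of_injective _ Sum.inl_injective, Set.ncard_compl, Set.ncard_pair ha']
    simp
  refine ⟨Sum.inl a', 2, Set.eq_univ_of_forall ?_⟩
  rintro (x | y)
  · refine closedNbhd_subset_monitored_succ (hright 1 b') ?_
      (Or.inr ((hadj x b').mpr fun h => hb' h.2).symm)
    have hsub : closedNbhd G (Sum.inr b') \ monitored G k {Sum.inl a'} 1 ⊆ {Sum.inl a} := by
      rintro (z | z) ⟨-, hz⟩
      · by_contra h
        exact hz (hleft z fun h' => h (congrArg Sum.inl h'))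
      · exact absurd (hright 1 z) hz
    refine (Set.ncard_le_ncard hsub (Set.toFinite _)).trans ?_
    rw [Set.ncard_singleton]
    exact hk
  · exact hright 2 y

theorem pdn_completeBipartite_edge_deletion (k : ℕ) (hk : 0 < k) :
    pdn (completeBipartiteGraph (Fin (k + 2)) (Fin (k + 2))) k = 2 ∧
    ∀ e ∈ (completeBipartiteGraph (Fin (k + 2)) (Fin (k + 2))).edgeSet,
      pdn ((completeBipartiteGraph (Fin (k + 2)) (Fin (k + 2))).deleteEdges {e}) k = 1 := by
  constructor
  · have hpair : ({Sum.inl 0, Sum.inr 0} : Set (Fin (k + 2) ⊕ Fin (k + 2))).ncard = 2 :=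
      Set.ncard_pair Sum.inl_ne_inr
    refine ((isPDS_pair_completeBipartiteGraph k 0 0).pdn_eq fun T hT => ?_).trans hpair
    rw [hpair]
    refine (one_le_ncard_of_isPDS hT).lt_of_ne fun h => ?_
    obtain ⟨v, rfl⟩ := Set.ncard_eq_one.mp h.symm
    exact not_isPDS_singleton_completeBipartiteGraph k v hT
  · intro e he
    obtain ⟨a, b, rfl⟩ : ∃ a b, e = s(Sum.inl a, Sum.inr b) := by
      induction e with
      | _ x y =>
        rcases x with a | a <;> rcases y with b | b <;> simp at he
        · exact ⟨a, b, rfl⟩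
        · exact ⟨b, a, Sym2.eq_swap⟩
    obtain ⟨v, hv⟩ := exists_isPDS_singleton_deleteEdges k hk a b
    rw [← Set.ncard_singleton v]
    refine hv.pdn_eq fun T hT => ?_
    rw [Set.ncard_singleton]
    exact one_le_ncard_of_isPDS hT
end
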